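/- arXiv:2406.02828 — 3 statements merged into one kernel-verified Lean document; each statement's English description precedes it below -/
import Mathlib

section
/- (Three-circle lemma for the Dirichlet energy of harmonic functions, Lemma A.1.) For every q ∈ (0,2) there exists L₀ > 0 (depending on q) such that for all L > L₀ the following holds. Let v : [0,3L]×ℝ → ℝ be harmonic (∂_t²v + ∂_θ²v = 0) and 2π-periodic in θ. If ∫_{Q₂} ( |∂_t v|² − |∂_θ v|² ) dt dθ = 0, then ∫_{Q₂} |∇v|² dt dθ ≤ e^{−qL} ( ∫_{Q₁} |∇v|² dt dθ + ∫_{Q₃} |∇v|² dt dθ ). -/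
noncomputable section

open Real MeasureTheory Set Filter
open scoped InnerProductSpace

/-- Partial derivative in the first variable. -/
def pt {F : Type*} [NormedAddCommGroup F] [NormedSpace ℝ F] (f : ℝ → ℝ → F) (t θ : ℝ) : F :=
  deriv (fun s => f s θ) t

/-- Partial derivative in the second variable. -/
def pth {F : Type*} [NormedAddCommGroup F] [NormedSpace ℝ F] (f : ℝ → ℝ → F) (t θ : ℝ) : F :=
  deriv (fun s => f t s) θ

variable {n : ℕ}

/-- Mean curvature vector `H = e^{-2u}(∂_t² f + ∂_θ² f)`. -/
def Hmc (f : ℝ → ℝ → EuclideanSpace ℝ (Fin n)) (u : ℝ → ℝ → ℝ) :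
    ℝ → ℝ → EuclideanSpace ℝ (Fin n) :=
  fun t θ => Real.exp (-(2 * u t θ)) • (pt (pt f) t θ + pth (pth f) t θ)

/-- Component `A_tt` of the second fundamental form. -/
def Att (f : ℝ → ℝ → EuclideanSpace ℝ (Fin n)) (u : ℝ → ℝ → ℝ) :
    ℝ → ℝ → EuclideanSpace ℝ (Fin n) :=
  fun t θ => pt (pt f) t θ - pt u t θ • pt f t θ + pth u t θ • pth f t θ

/-- Component `A_tθ` of the second fundamental form. -/
def Atth (f : ℝ → ℝ → EuclideanSpace ℝ (Fin n)) (u : ℝ → ℝ → ℝ) :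
    ℝ → ℝ → EuclideanSpace ℝ (Fin n) :=
  fun t θ => pt (pth f) t θ - pth u t θ • pt f t θ - pt u t θ • pth f t θ

/-- Component `A_θθ` of the second fundamental form. -/
def Athth (f : ℝ → ℝ → EuclideanSpace ℝ (Fin n)) (u : ℝ → ℝ → ℝ) :
    ℝ → ℝ → EuclideanSpace ℝ (Fin n) :=
  fun t θ => pth (pth f) t θ + pt u t θ • pt f t θ - pth u t θ • pth f t θ

/-- `|A|²`, the squared norm of the second fundamental form. -/
def Asq (f : ℝ → ℝ → EuclideanSpace ℝ (Fin n)) (u : ℝ → ℝ → ℝ) : ℝ → ℝ → ℝ :=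
  fun t θ => Real.exp (-(4 * u t θ)) *
    (‖Att f u t θ‖ ^ 2 + 2 * ‖Atth f u t θ‖ ^ 2 + ‖Athth f u t θ‖ ^ 2)

/-- The left-hand side of the Willmore equation in conformal coordinates. -/
def willmoreOp (f : ℝ → ℝ → EuclideanSpace ℝ (Fin n)) (u : ℝ → ℝ → ℝ) :
    ℝ → ℝ → EuclideanSpace ℝ (Fin n) :=
  fun t θ =>
    (2 : ℝ) • (pt (pt (Hmc f u)) t θ + pth (pth (Hmc f u)) t θ)
    + (4 : ℝ) • pt (fun a b => Real.exp (-(2 * u a b)) •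
        (⟪Hmc f u a b, Att f u a b⟫_ℝ • pt f a b + ⟪Hmc f u a b, Atth f u a b⟫_ℝ • pth f a b)) t θ
    + (4 : ℝ) • pth (fun a b => Real.exp (-(2 * u a b)) •
        (⟪Hmc f u a b, Atth f u a b⟫_ℝ • pt f a b + ⟪Hmc f u a b, Athth f u a b⟫_ℝ • pth f a b)) t θ
    - pt (fun a b => ‖Hmc f u a b‖ ^ 2 • pt f a b) t θ
    - pth (fun a b => ‖Hmc f u a b‖ ^ 2 • pth f a b) t θ

/-- A conformal immersion of a cylinder `s × S¹` (in the `t` variable),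
with conformal factor `e^{2u}`; maps are `2π`-periodic in the second variable. -/
structure ConfImm (f : ℝ → ℝ → EuclideanSpace ℝ (Fin n)) (u : ℝ → ℝ → ℝ) (s : Set ℝ) :
    Prop where
  smooth_f : ContDiff ℝ (⊤ : ℕ∞) (fun p : ℝ × ℝ => f p.1 p.2)
  smooth_u : ContDiff ℝ (⊤ : ℕ∞) (fun p : ℝ × ℝ => u p.1 p.2)
  periodic_f : ∀ t θ, f t (θ + 2 * π) = f t θ
  periodic_u : ∀ t θ, u t (θ + 2 * π) = u t θ
  conf_t : ∀ t ∈ s, ∀ θ : ℝ, ‖pt f t θ‖ ^ 2 = Real.exp (2 * u t θ)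
  conf_th : ∀ t ∈ s, ∀ θ : ℝ, ‖pth f t θ‖ ^ 2 = Real.exp (2 * u t θ)
  conf_orth : ∀ t ∈ s, ∀ θ : ℝ, ⟪pt f t θ, pth f t θ⟫_ℝ = 0

/-- A conformal Willmore immersion of a cylinder. -/
structure ConfWillmore (f : ℝ → ℝ → EuclideanSpace ℝ (Fin n)) (u : ℝ → ℝ → ℝ) (s : Set ℝ)
    extends ConfImm f u s : Prop where
  willmore : ∀ t ∈ s, ∀ θ : ℝ, willmoreOp f u t θ = 0

/-- The first residue `τ₁(f,c)(t)`. -/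
def tau1 (f : ℝ → ℝ → EuclideanSpace ℝ (Fin n)) (u : ℝ → ℝ → ℝ)
    (c : EuclideanSpace ℝ (Fin n)) (t : ℝ) : ℝ :=
  ⟪(-2 : ℝ) • (∫ θ in (0 : ℝ)..(2 * π), pt (Hmc f u) t θ)
    - (4 : ℝ) • (∫ θ in (0 : ℝ)..(2 * π), Real.exp (-(2 * u t θ)) •
        (⟪Hmc f u t θ, Att f u t θ⟫_ℝ • pt f t θ + ⟪Hmc f u t θ, Atth f u t θ⟫_ℝ • pth f t θ))
    + ∫ θ in (0 : ℝ)..(2 * π), ‖Hmc f u t θ‖ ^ 2 • pt f t θ, c⟫_ℝ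

/-- The second residue `τ₂(f,S)(t)`, for a matrix `S`. -/
def tau2 (f : ℝ → ℝ → EuclideanSpace ℝ (Fin n)) (u : ℝ → ℝ → ℝ)
    (S : Matrix (Fin n) (Fin n) ℝ) (t : ℝ) : ℝ :=
  2 * (∫ θ in (0 : ℝ)..(2 * π),
        (⟪Hmc f u t θ, pt (fun a b => (Matrix.toEuclideanLin S) (f a b)) t θ⟫_ℝ
          - ⟪pt (Hmc f u) t θ, (Matrix.toEuclideanLin S) (f t θ)⟫_ℝ))
  - 4 * (∫ θ in (0 : ℝ)..(2 * π), Real.exp (-(2 * u t θ)) *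
        (⟪Hmc f u t θ, Att f u t θ⟫_ℝ * ⟪pt f t θ, (Matrix.toEuclideanLin S) (f t θ)⟫_ℝ
          + ⟪Hmc f u t θ, Atth f u t θ⟫_ℝ * ⟪pth f t θ, (Matrix.toEuclideanLin S) (f t θ)⟫_ℝ))
  + ∫ θ in (0 : ℝ)..(2 * π), ‖Hmc f u t θ‖ ^ 2 * ⟪pt f t θ, (Matrix.toEuclideanLin S) (f t θ)⟫_ℝ

/-- Pointwise norm of the gradient of a scalar function on the cylinder. -/
def gradNorm (u : ℝ → ℝ → ℝ) (t θ : ℝ) : ℝ :=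
  Real.sqrt ((pt u t θ) ^ 2 + (pth u t θ) ^ 2)

/-- Integral of a density over the piece `[a,b] × S¹` of the cylinder. -/
def cylInt (F : ℝ → ℝ → ℝ) (a b : ℝ) : ℝ :=
  ∫ p in Set.Icc a b ×ˢ Set.Icc (0 : ℝ) (2 * π), F p.1 p.2

/-- The density `|A|² dV_g` (with respect to `dt dθ`). -/
def Adens (f : ℝ → ℝ → EuclideanSpace ℝ (Fin n)) (u : ℝ → ℝ → ℝ) : ℝ → ℝ → ℝ :=
  fun t θ => Asq f u t θ * Real.exp (2 * u t θ)

/-- The density `|H|² dV_g` (with respect to `dt dθ`). -/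
def Hdens (f : ℝ → ℝ → EuclideanSpace ℝ (Fin n)) (u : ℝ → ℝ → ℝ) : ℝ → ℝ → ℝ :=
  fun t θ => ‖Hmc f u t θ‖ ^ 2 * Real.exp (2 * u t θ)

section PlaneCalculus

/-- Smoothness of a real function of two variables. -/
abbrev SmoothPlane (F : ℝ → ℝ → ℝ) : Prop :=
  ContDiff ℝ (⊤ : ℕ∞) (fun p : ℝ × ℝ => F p.1 p.2)

/-- Integral over the circle `{t} × S¹`. -/
def circInt (F : ℝ → ℝ → ℝ) (t : ℝ) : ℝ :=
  ∫ θ in (0 : ℝ)..(2 * π), F t θ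

variable {F G : ℝ → ℝ → ℝ}

lemma SmoothPlane.hasDerivAt_fst (hF : SmoothPlane F) (t θ : ℝ) :
    HasDerivAt (fun s => F s θ) (fderiv ℝ (fun p : ℝ × ℝ => F p.1 p.2) (t, θ) (1, 0)) t := by
  have h := (hF.differentiable (by simp) (t, θ)).hasFDerivAt
  have h2 : HasDerivAt (fun s : ℝ => (s, θ)) (1, 0) t :=
    (hasDerivAt_id t).prodMk (hasDerivAt_const t θ)
  exact h.comp_hasDerivAt t h2

lemma SmoothPlane.hasDerivAt_snd (hF : SmoothPlane F) (t θ : ℝ) :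
    HasDerivAt (fun s => F t s) (fderiv ℝ (fun p : ℝ × ℝ => F p.1 p.2) (t, θ) (0, 1)) θ := by
  have h := (hF.differentiable (by simp) (t, θ)).hasFDerivAt
  have h2 : HasDerivAt (fun s : ℝ => (t, s)) (0, 1) θ :=
    (hasDerivAt_const θ t).prodMk (hasDerivAt_id θ)
  exact h.comp_hasDerivAt θ h2

lemma SmoothPlane.pt_eq (hF : SmoothPlane F) (t θ : ℝ) :
    pt F t θ = fderiv ℝ (fun p : ℝ × ℝ => F p.1 p.2) (t, θ) (1, 0) :=
  (hF.hasDerivAt_fst t θ).deriv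

lemma SmoothPlane.pth_eq (hF : SmoothPlane F) (t θ : ℝ) :
    pth F t θ = fderiv ℝ (fun p : ℝ × ℝ => F p.1 p.2) (t, θ) (0, 1) :=
  (hF.hasDerivAt_snd t θ).deriv

lemma SmoothPlane.hasDerivAt_pt (hF : SmoothPlane F) (t θ : ℝ) :
    HasDerivAt (fun s => F s θ) (pt F t θ) t :=
  (hF.hasDerivAt_fst t θ).differentiableAt.hasDerivAt

lemma SmoothPlane.hasDerivAt_pth (hF : SmoothPlane F) (t θ : ℝ) :
    HasDerivAt (fun s => F t s) (pth F t θ) θ :=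
  (hF.hasDerivAt_snd t θ).differentiableAt.hasDerivAt

lemma SmoothPlane.contDiff_fderiv (hF : SmoothPlane F) :
    ContDiff ℝ (⊤ : ℕ∞) (fderiv ℝ (fun p : ℝ × ℝ => F p.1 p.2)) :=
  hF.fderiv_right (by simp)

lemma SmoothPlane.pt (hF : SmoothPlane F) : SmoothPlane (pt F) := by
  have h : (fun p : ℝ × ℝ => _root_.pt F p.1 p.2) =
      fun p => fderiv ℝ (fun p : ℝ × ℝ => F p.1 p.2) p (1, 0) :=
    funext fun p => hF.pt_eq p.1 p.2
  rw [SmoothPlane, h]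
  exact hF.contDiff_fderiv.clm_apply contDiff_const

lemma SmoothPlane.pth (hF : SmoothPlane F) : SmoothPlane (pth F) := by
  have h : (fun p : ℝ × ℝ => _root_.pth F p.1 p.2) =
      fun p => fderiv ℝ (fun p : ℝ × ℝ => F p.1 p.2) p (0, 1) :=
    funext fun p => hF.pth_eq p.1 p.2
  rw [SmoothPlane, h]
  exact hF.contDiff_fderiv.clm_apply contDiff_const

lemma SmoothPlane.pt_pth_comm (hF : SmoothPlane F) (t θ : ℝ) :
    _root_.pt (_root_.pth F) t θ = _root_.pth (_root_.pt F) t θ := by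
  set f : ℝ × ℝ → ℝ := fun p => F p.1 p.2
  have hd : HasFDerivAt (fderiv ℝ f) (fderiv ℝ (fderiv ℝ f) (t, θ)) (t, θ) :=
    (hF.contDiff_fderiv.differentiable (by simp) _).hasFDerivAt
  have happ : ∀ w : ℝ × ℝ, HasFDerivAt (fun p => fderiv ℝ f p w)
      ((fderiv ℝ (fderiv ℝ f) (t, θ)).flip w) (t, θ) := fun w => by
    simpa using hd.clm_apply (hasFDerivAt_const w (t, θ))
  have h1 : (fun p : ℝ × ℝ => _root_.pth F p.1 p.2) = fun p => fderiv ℝ f p (0, 1) :=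
    funext fun p => hF.pth_eq p.1 p.2
  have h2 : (fun p : ℝ × ℝ => _root_.pt F p.1 p.2) = fun p => fderiv ℝ f p (1, 0) :=
    funext fun p => hF.pt_eq p.1 p.2
  rw [hF.pth.pt_eq, hF.pt.pth_eq, h1, h2, (happ _).fderiv, (happ _).fderiv]
  exact second_derivative_symmetric
    (fun y => (hF.differentiable (by simp) y).hasFDerivAt) hd _ _

lemma SmoothPlane.continuous_snd (hF : SmoothPlane F) (t : ℝ) : Continuous (F t) :=
  hF.continuous.comp (by fun_prop : Continuous fun θ : ℝ => (t, θ))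

lemma SmoothPlane.intervalIntegrable (hF : SmoothPlane F) (t a b : ℝ) :
    IntervalIntegrable (F t) volume a b :=
  (hF.continuous_snd t).intervalIntegrable a b

lemma pt_periodic {c : ℝ} (hp : ∀ t θ, F t (θ + c) = F t θ) (t θ : ℝ) :
    pt F t (θ + c) = pt F t θ := by
  simp only [pt, hp]

lemma pth_periodic {c : ℝ} (hp : ∀ t θ, F t (θ + c) = F t θ) (t θ : ℝ) :
    pth F t (θ + c) = pth F t θ := by
  have h := deriv_comp_add_const (F t) c θ
  simp only [hp] at h
  exact h.symm

lemma SmoothPlane.hasDerivAt_circInt (hF : SmoothPlane F) (t : ℝ) :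
    HasDerivAt (circInt F) (circInt (_root_.pt F) t) t := by
  obtain ⟨C, hC⟩ := ((isCompact_Icc (a := t - 1) (b := t + 1)).prod
    (isCompact_uIcc (a := (0 : ℝ)) (b := 2 * π))).exists_bound_of_continuousOn
      hF.pt.continuous.continuousOn
  refine (intervalIntegral.hasDerivAt_integral_of_dominated_loc_of_deriv_le
    (bound := fun _ => C) (Icc_mem_nhds (by linarith : t - 1 < t) (by linarith : t < t + 1))
    (Eventually.of_forall fun s => (hF.continuous_snd s).aestronglyMeasurable)
    (hF.intervalIntegrable t _ _) (hF.pt.continuous_snd t).aestronglyMeasurable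
    (Eventually.of_forall fun θ hθ s hs => hC (s, θ) ⟨hs, uIoc_subset_uIcc hθ⟩)
    intervalIntegrable_const
    (Eventually.of_forall fun θ _ s _ => hF.hasDerivAt_pt s θ)).2

lemma SmoothPlane.continuous_circInt (hF : SmoothPlane F) : Continuous (circInt F) :=
  continuous_iff_continuousAt.2 fun t => (hF.hasDerivAt_circInt t).continuousAt

lemma SmoothPlane.cylInt_eq (hF : SmoothPlane F) {a b : ℝ} (hab : a ≤ b) :
    cylInt F a b = ∫ t in a..b, circInt F t := by
  have hint : IntegrableOn (fun p : ℝ × ℝ => F p.1 p.2)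
      (Set.Icc a b ×ˢ Set.Icc (0 : ℝ) (2 * π)) (volume.prod volume) :=
    hF.continuous.continuousOn.integrableOn_compact (isCompact_Icc.prod isCompact_Icc)
  rw [cylInt, Measure.volume_eq_prod, setIntegral_prod _ hint,
    intervalIntegral.integral_of_le hab, integral_Icc_eq_integral_Ioc]
  simp only [circInt, intervalIntegral.integral_of_le Real.two_pi_pos.le,
    integral_Icc_eq_integral_Ioc]

lemma SmoothPlane.circInt_pth (hF : SmoothPlane F) (hp : ∀ t θ, F t (θ + 2 * π) = F t θ)
    (t : ℝ) : circInt (_root_.pth F) t = 0 := by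
  rw [circInt, intervalIntegral.integral_eq_sub_of_hasDerivAt
    (fun θ _ => hF.hasDerivAt_pth t θ) (hF.pth.intervalIntegrable t _ _)]
  have := hp t 0
  rw [zero_add] at this
  rw [this, sub_self]

lemma SmoothPlane.circInt_mul_pth (hF : SmoothPlane F) (hG : SmoothPlane G)
    (hpF : ∀ t θ, F t (θ + 2 * π) = F t θ) (hpG : ∀ t θ, G t (θ + 2 * π) = G t θ) (t : ℝ) :
    circInt (fun t θ => F t θ * _root_.pth G t θ) t
      = -circInt (fun t θ => _root_.pth F t θ * G t θ) t := by
  have h := intervalIntegral.integral_mul_deriv_eq_deriv_mul (a := 0) (b := 2 * π)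
    (fun θ _ => hF.hasDerivAt_pth t θ) (fun θ _ => hG.hasDerivAt_pth t θ)
    (hF.pth.intervalIntegrable t _ _) (hG.pth.intervalIntegrable t _ _)
  have h1 := hpF t 0
  have h2 := hpG t 0
  rw [zero_add] at h1 h2
  rw [h1, h2, sub_self, zero_sub] at h
  exact h

end PlaneCalculus

section Inequalities

/-- Cauchy-Schwarz inequality for a function and a constant on `[0, 2π]`. -/
lemma sq_integral_le_two_pi_mul {w : ℝ → ℝ} (hw : Continuous w) :
    (∫ x in (0 : ℝ)..(2 * π), w x) ^ 2 / (2 * π) ≤ ∫ x in (0 : ℝ)..(2 * π), w x ^ 2 := by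
  set m := (∫ x in (0 : ℝ)..(2 * π), w x) / (2 * π) with hm
  have h0 : 0 ≤ ∫ x in (0 : ℝ)..(2 * π), (w x - m) ^ 2 :=
    intervalIntegral.integral_nonneg Real.two_pi_pos.le fun x _ => sq_nonneg _
  have h1 : ∫ x in (0 : ℝ)..(2 * π), (w x - m) ^ 2
      = (∫ x in (0 : ℝ)..(2 * π), w x ^ 2) - 2 * m * (∫ x in (0 : ℝ)..(2 * π), w x)
        + m ^ 2 * (2 * π) := by
    have e : ∀ x, (w x - m) ^ 2 = w x ^ 2 - 2 * m * w x + m ^ 2 := fun x => by ring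
    simp only [e]
    rw [intervalIntegral.integral_add, intervalIntegral.integral_sub,
      intervalIntegral.integral_const_mul, intervalIntegral.integral_const]
    · simp [mul_comm]
    all_goals exact Continuous.intervalIntegrable (by fun_prop) _ _
  have h2 : (∫ x in (0 : ℝ)..(2 * π), w x) = m * (2 * π) := by
    rw [hm]; field_simp
  rw [h1] at h0
  rw [h2] at h0 ⊢
  have h3 : (m * (2 * π)) ^ 2 / (2 * π) = m ^ 2 * (2 * π) := by field_simp
  rw [h3]
  linarith

/-- Wirtinger's inequality on the circle, without normalization of the mean. -/
lemma wirtinger_inequality {w w' : ℝ → ℝ} (hw : ∀ x, HasDerivAt w (w' x) x)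
    (hc : Continuous w') (hp : w (2 * π) = w 0) :
    (∫ x in (0 : ℝ)..(2 * π), w x ^ 2) - (∫ x in (0 : ℝ)..(2 * π), w x) ^ 2 / (2 * π)
      ≤ ∫ x in (0 : ℝ)..(2 * π), w' x ^ 2 := by
  have hwc : Continuous w := continuous_iff_continuousAt.2 fun x => (hw x).continuousAt
  have h2π : (0 : ℝ) < 2 * π := Real.two_pi_pos
  have hL2 : ∀ {g : ℝ → ℝ}, Continuous g →
      MemLp (fun x => (g x : ℂ)) 2 (volume.restrict (Ioc 0 (2 * π))) := fun hg => by
    have hgc := Complex.continuous_ofReal.comp hg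
    obtain ⟨C, hC⟩ := (isCompact_Icc (a := (0 : ℝ)) (b := 2 * π)).exists_bound_of_continuousOn
      hgc.continuousOn
    exact MemLp.of_bound hgc.aestronglyMeasurable C
      ((ae_restrict_iff' measurableSet_Ioc).2
        (Eventually.of_forall fun x hx => hC x (Ioc_subset_Icc_self hx)))
  have hs := hasSum_sq_fourierCoeffOn h2π (hL2 hwc)
  have hs' := hasSum_sq_fourierCoeffOn h2π (hL2 hc)
  set c := fourierCoeffOn h2π (fun x => (w x : ℂ))
  set c' := fourierCoeffOn h2π (fun x => (w' x : ℂ))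
  have hcoeff : ∀ k : ℤ, k ≠ 0 → ‖c k‖ ^ 2 ≤ ‖c' k‖ ^ 2 := fun k hk => by
    have h := fourierCoeffOn_of_hasDerivAt h2π hk (f := fun x => (w x : ℂ))
      (f' := fun x => (w' x : ℂ)) (fun x _ => (hw x).ofReal_comp)
      ((Complex.continuous_ofReal.comp hc).intervalIntegrable _ _)
    have hn : ‖c k‖ = ‖c' k‖ / |(k : ℝ)| := by
      change ‖fourierCoeffOn h2π (fun x => (w x : ℂ)) k‖ = _
      rw [h, hp]
      simp only [sub_self, mul_zero, zero_sub, sub_zero, norm_mul, norm_neg, norm_div, norm_one,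
        Complex.norm_I, Complex.norm_intCast, Complex.norm_real, Complex.norm_ofNat,
        Complex.ofReal_mul, Complex.ofReal_ofNat, Complex.ofReal_zero, Real.norm_eq_abs,
        abs_of_pos Real.pi_pos, c']
      field_simp
    have hk1 : (1 : ℝ) ≤ |(k : ℝ)| := by exact_mod_cast Int.one_le_abs hk
    have : ‖c k‖ ≤ ‖c' k‖ := hn ▸ div_le_self (norm_nonneg _) hk1
    gcongr
  have hle := hasSum_le (fun k => ?_) (hs.sub (hasSum_ite_eq (0 : ℤ) (‖c 0‖ ^ 2))) hs'
  · have hc0 : ‖c 0‖ ^ 2 = ((2 * π)⁻¹ * ∫ x in (0 : ℝ)..(2 * π), w x) ^ 2 := by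
      have : c 0 = (((2 * π)⁻¹ * ∫ x in (0 : ℝ)..(2 * π), w x : ℝ) : ℂ) := by
        simp [c, fourierCoeffOn_eq_integral, intervalIntegral.integral_ofReal]
      rw [this, Complex.norm_real, Real.norm_eq_abs, sq_abs]
    rw [hc0] at hle
    simp only [Complex.norm_real, Real.norm_eq_abs, sq_abs, sub_zero, smul_eq_mul] at hle
    have h := mul_le_mul_of_nonneg_left hle h2π.le
    rw [mul_sub, mul_inv_cancel_left₀ h2π.ne', mul_inv_cancel_left₀ h2π.ne'] at h
    refine le_of_eq_of_le ?_ h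
    field_simp
  · by_cases hk : k = 0
    · simp [hk]
    · simpa [hk] using hcoeff k hk

/-- Comparison of a solution of `k² G ≤ G''` with the hyperbolic cosine. -/
lemma two_mul_cosh_mul_le_add {G G' G'' : ℝ → ℝ} {k a b : ℝ}
    (hG : ∀ t, HasDerivAt G (G' t) t) (hG' : ∀ t, HasDerivAt G' (G'' t) t)
    (h : ∀ t ∈ Set.Icc a b, k ^ 2 * G t ≤ G'' t) {t r : ℝ} (hr : 0 ≤ r)
    (ha : a ≤ t - r) (hb : t + r ≤ b) :
    2 * Real.cosh (k * r) * G t ≤ G (t - r) + G (t + r) := by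
  set φ : ℝ → ℝ := fun s => G (t - s) + G (t + s)
  set φ' : ℝ → ℝ := fun s => -G' (t - s) + G' (t + s)
  set φ'' : ℝ → ℝ := fun s => G'' (t - s) + G'' (t + s)
  have hφ : ∀ s, HasDerivAt φ (φ' s) s := fun s =>
    ((hG (t - s)).comp_const_sub t s).add ((hG (t + s)).comp_const_add t s)
  have hφ' : ∀ s, HasDerivAt φ' (φ'' s) s := fun s => by
    refine (((hG' (t - s)).comp_const_sub t s).neg.add
      ((hG' (t + s)).comp_const_add t s)).congr_deriv ?_
    rw [neg_neg]
  have hlin : ∀ s, HasDerivAt (fun s : ℝ => k * s) k s := fun s => by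
    simpa using (hasDerivAt_id s).const_mul k
  have hch : ∀ s, HasDerivAt (fun s => Real.cosh (k * s)) (Real.sinh (k * s) * k) s := fun s =>
    (hlin s).cosh
  have hsh : ∀ s, HasDerivAt (fun s => Real.sinh (k * s)) (Real.cosh (k * s) * k) s := fun s =>
    (hlin s).sinh
  set D : ℝ → ℝ := fun s => φ' s * Real.cosh (k * s) - φ s * (Real.sinh (k * s) * k)
  have hD : ∀ s, HasDerivAt D ((φ'' s - k ^ 2 * φ s) * Real.cosh (k * s)) s := fun s => by
    refine (((hφ' s).mul (hch s)).sub ((hφ s).mul ((hsh s).mul_const k))).congr_deriv ?_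
    ring
  have hDmono : MonotoneOn D (Set.Icc 0 r) :=
    monotoneOn_of_hasDerivWithinAt_nonneg (convex_Icc 0 r)
      (fun s _ => (hD s).continuousAt.continuousWithinAt) (fun s _ => (hD s).hasDerivWithinAt)
      fun s hs => by
        rw [interior_Icc] at hs
        have h1 := h (t - s) ⟨by linarith [hs.2], by linarith [hs.1]⟩
        have h2 := h (t + s) ⟨by linarith [hs.1], by linarith [hs.2]⟩
        refine mul_nonneg ?_ (Real.cosh_pos _).le
        simp only [φ'', φ]
        linarith
  have hD0 : D 0 = 0 := by simp [D, φ']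
  have hDnn : ∀ s ∈ Set.Icc 0 r, 0 ≤ D s := fun s hs =>
    hD0 ▸ hDmono (left_mem_Icc.2 hr) hs hs.1
  have hQ : ∀ s, HasDerivAt (fun s => φ s / Real.cosh (k * s)) (D s / Real.cosh (k * s) ^ 2) s :=
    fun s => (hφ s).div (hch s) (Real.cosh_pos _).ne'
  have hQmono : MonotoneOn (fun s => φ s / Real.cosh (k * s)) (Set.Icc 0 r) :=
    monotoneOn_of_hasDerivWithinAt_nonneg (convex_Icc 0 r)
      (fun s _ => (hQ s).continuousAt.continuousWithinAt) (fun s _ => (hQ s).hasDerivWithinAt)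
      fun s hs => div_nonneg (hDnn s (interior_subset hs)) (sq_nonneg _)
  have hfin := hQmono (left_mem_Icc.2 hr) (right_mem_Icc.2 hr) hr
  simp only [mul_zero, Real.cosh_zero, div_one, φ, sub_zero, add_zero] at hfin
  rw [le_div_iff₀ (Real.cosh_pos _)] at hfin
  linarith

end Inequalities

section HarmonicEnergy

variable {v : ℝ → ℝ → ℝ} {T : ℝ}

/-- For a harmonic function, the Hopf differential has constant integral over circles. -/
lemma circInt_hopf_eq (hv : SmoothPlane v) (hp : ∀ t θ, v t (θ + 2 * π) = v t θ)
    (hh : ∀ t ∈ Set.Icc (0 : ℝ) T, ∀ θ, pt (pt v) t θ + pth (pth v) t θ = 0) :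
    ∀ t ∈ Set.Icc (0 : ℝ) T, circInt (fun t θ => pt v t θ ^ 2 - pth v t θ ^ 2) t
      = circInt (fun t θ => pt v t θ ^ 2 - pth v t θ ^ 2) 0 := by
  have hs : SmoothPlane (fun t θ => pt v t θ ^ 2 - pth v t θ ^ 2) :=
    (hv.pt.pow 2).sub (hv.pth.pow 2)
  have hm : SmoothPlane (fun t θ => -2 * (pt v t θ * pth v t θ)) :=
    contDiff_const.mul (hv.pt.mul hv.pth)
  refine constant_of_has_deriv_right_zero hs.continuous_circInt.continuousOn fun t ht => ?_
  refine ((hs.hasDerivAt_circInt t).congr_deriv ?_).hasDerivWithinAt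
  rw [← hm.circInt_pth (fun t θ => by rw [pt_periodic hp, pth_periodic hp]) t]
  refine intervalIntegral.integral_congr fun θ _ => ?_
  have h1 := (((hv.pt.hasDerivAt_pt t θ).pow 2).sub ((hv.pth.hasDerivAt_pt t θ).pow 2)).deriv
  have h2 := (((hv.pt.hasDerivAt_pth t θ).mul (hv.pth.hasDerivAt_pth t θ)).const_mul (-2)).deriv
  refine h1.trans (Eq.trans ?_ h2.symm)
  have h3 := hh t (Ico_subset_Icc_self ht) θ
  rw [hv.pt_pth_comm, eq_neg_of_add_eq_zero_left h3]
  simp only [Nat.add_one_sub_one, pow_one, Nat.cast_ofNat]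
  ring

/-- For a harmonic function, the flux through circles is constant. -/
lemma circInt_pt_eq (hv : SmoothPlane v) (hp : ∀ t θ, v t (θ + 2 * π) = v t θ)
    (hh : ∀ t ∈ Set.Icc (0 : ℝ) T, ∀ θ, pt (pt v) t θ + pth (pth v) t θ = 0) :
    ∀ t ∈ Set.Icc (0 : ℝ) T, circInt (pt v) t = circInt (pt v) 0 := by
  refine constant_of_has_deriv_right_zero hv.pt.continuous_circInt.continuousOn fun t ht => ?_
  refine ((hv.pt.hasDerivAt_circInt t).congr_deriv ?_).hasDerivWithinAt
  rw [← neg_zero, ← hv.pth.circInt_pth (pth_periodic hp) t, circInt, circInt,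
    ← intervalIntegral.integral_neg]
  exact intervalIntegral.integral_congr fun θ _ =>
    eq_neg_of_add_eq_zero_left (hh t (Ico_subset_Icc_self ht) θ)

lemma hasDerivAt_circInt_sq {b : ℝ → ℝ → ℝ} (hb : SmoothPlane b) (t : ℝ) :
    HasDerivAt (circInt fun t θ => b t θ ^ 2) (circInt (fun t θ => 2 * (b t θ * pt b t θ)) t) t := by
  have hs : SmoothPlane (fun t θ => b t θ ^ 2) := hb.pow 2
  refine (hs.hasDerivAt_circInt t).congr_deriv
    (intervalIntegral.integral_congr fun θ _ => ((hb.hasDerivAt_pt t θ).pow 2).deriv.trans ?_)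
  simp only [Nat.add_one_sub_one, pow_one, Nat.cast_ofNat]
  ring

lemma hasDerivAt_circInt_two_mul_mul_pt {b : ℝ → ℝ → ℝ} (hb : SmoothPlane b) (t : ℝ) :
    HasDerivAt (circInt fun t θ => 2 * (b t θ * pt b t θ))
      (2 * circInt (fun t θ => pt b t θ ^ 2) t
        + 2 * circInt (fun t θ => b t θ * pt (pt b) t θ) t) t := by
  have hs : SmoothPlane (fun t θ => 2 * (b t θ * pt b t θ)) :=
    contDiff_const.mul (hb.mul hb.pt)
  have h1 : SmoothPlane (fun t θ => pt b t θ ^ 2) := hb.pt.pow 2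
  have h2 : SmoothPlane (fun t θ => b t θ * pt (pt b) t θ) := hb.mul hb.pt.pt
  refine (hs.hasDerivAt_circInt t).congr_deriv ?_
  rw [circInt, circInt, circInt, ← mul_add, ← intervalIntegral.integral_add
    (h1.intervalIntegrable t _ _) (h2.intervalIntegrable t _ _),
    ← intervalIntegral.integral_const_mul]
  refine intervalIntegral.integral_congr fun θ _ =>
    (((hb.hasDerivAt_pt t θ).mul (hb.pt.hasDerivAt_pt t θ)).const_mul 2).deriv.trans ?_
  ring

/-- Wirtinger's inequality on circles. -/
lemma circInt_sq_sub_le {b : ℝ → ℝ → ℝ} (hb : SmoothPlane b)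
    (hp : ∀ t θ, b t (θ + 2 * π) = b t θ) (t : ℝ) :
    circInt (fun t θ => b t θ ^ 2) t - circInt b t ^ 2 / (2 * π)
      ≤ circInt (fun t θ => pth b t θ ^ 2) t := by
  refine wirtinger_inequality (hb.hasDerivAt_pth t) (hb.pth.continuous_snd t) ?_
  have := hp t 0
  rwa [zero_add] at this

/-- Lower bound for the second derivative of the angular energy of a harmonic function whose
Hopf differential integrates to zero over a circle. -/
lemma four_mul_angular_energy_le (hv : SmoothPlane v) (hp : ∀ t θ, v t (θ + 2 * π) = v t θ)
    {t : ℝ} (hh : ∀ θ, pt (pt v) t θ + pth (pth v) t θ = 0)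
    (hf : circInt (fun t θ => pt v t θ ^ 2) t = circInt (fun t θ => pth v t θ ^ 2) t) :
    2 ^ 2 * (circInt (fun t θ => pth v t θ ^ 2) t - circInt (pt v) t ^ 2 / (4 * π))
      ≤ 2 * circInt (fun t θ => pt (pth v) t θ ^ 2) t
        + 2 * circInt (fun t θ => pth v t θ * pt (pt (pth v)) t θ) t := by
  have hcomm : pt (pth v) = pth (pt v) := funext fun t => funext fun θ => hv.pt_pth_comm t θ
  have hcomm2 : pt (pt (pth v)) = pth (pt (pt v)) := by
    rw [hcomm]
    exact funext fun t => funext fun θ => hv.pt.pt_pth_comm t θ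
  have h1 := circInt_sq_sub_le hv.pt (pt_periodic hp) t
  have h2 := circInt_sq_sub_le hv.pth (pth_periodic hp) t
  rw [hv.circInt_pth hp] at h2
  have h3 : circInt (fun t θ => pth v t θ * pth (pt (pt v)) t θ) t
      = circInt (fun t θ => pth (pth v) t θ ^ 2) t := by
    rw [hv.pth.circInt_mul_pth hv.pt.pt (pth_periodic hp) (pt_periodic (pt_periodic hp)),
      circInt, circInt, ← intervalIntegral.integral_neg]
    refine intervalIntegral.integral_congr fun θ _ => ?_
    simp only [eq_neg_of_add_eq_zero_left (hh θ)]
    ring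
  rw [hcomm2, hcomm, h3]
  rw [hf] at h1
  have h4 : circInt (pt v) t ^ 2 / (2 * π) = 2 * (circInt (pt v) t ^ 2 / (4 * π)) := by
    field_simp
    norm_num
  rw [h4] at h1
  simp only [ne_eq, OfNat.ofNat_ne_zero, not_false_eq_true, zero_pow, zero_div, sub_zero] at h2
  linarith

end HarmonicEnergy

/-- **Lemma A.1** (three-circle lemma for the Dirichlet energy of harmonic functions). -/
theorem three_circle_dirichlet_harmonic (q : ℝ) (hq0 : 0 < q) (hq2 : q < 2) :
    ∃ L₀ > (0 : ℝ), ∀ L > L₀, ∀ v : ℝ → ℝ → ℝ,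
      ContDiff ℝ (⊤ : ℕ∞) (fun p : ℝ × ℝ => v p.1 p.2) →
      (∀ t θ : ℝ, v t (θ + 2 * π) = v t θ) →
      (∀ t ∈ Set.Icc (0 : ℝ) (3 * L), ∀ θ : ℝ, pt (pt v) t θ + pth (pth v) t θ = 0) →
      cylInt (fun t θ => (pt v t θ) ^ 2 - (pth v t θ) ^ 2) L (2 * L) = 0 →
      cylInt (fun t θ => (pt v t θ) ^ 2 + (pth v t θ) ^ 2) L (2 * L)
        ≤ Real.exp (-q * L) *
          (cylInt (fun t θ => (pt v t θ) ^ 2 + (pth v t θ) ^ 2) 0 L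
            + cylInt (fun t θ => (pt v t θ) ^ 2 + (pth v t θ) ^ 2) (2 * L) (3 * L)) := by
  refine ⟨Real.log 2 / (2 - q), div_pos (Real.log_pos one_lt_two) (by linarith), ?_⟩
  intro L hL v hv hp hh hf
  replace hv : SmoothPlane v := hv
  have h2q : 0 < 2 - q := by linarith
  have hL0 : 0 < L := lt_trans (div_pos (Real.log_pos one_lt_two) h2q) hL
  have hcosh : Real.exp (q * L) ≤ Real.cosh (2 * L) := by
    rw [gt_iff_lt, div_lt_iff₀ h2q] at hL
    have h1 : 2 * Real.exp (q * L) ≤ Real.exp (2 * L) := by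
      rw [← Real.exp_log two_pos, ← Real.exp_add, Real.exp_log two_pos]
      exact Real.exp_le_exp.2 (by linarith)
    rw [Real.cosh_eq]
    linarith [Real.exp_pos (-(2 * L))]
  have hsa : SmoothPlane (fun t θ => pt v t θ ^ 2) := hv.pt.pow 2
  have hsb : SmoothPlane (fun t θ => pth v t θ ^ 2) := hv.pth.pow 2
  have hzero : ∀ t ∈ Set.Icc (0 : ℝ) (3 * L),
      circInt (fun t θ => pt v t θ ^ 2) t = circInt (fun t θ => pth v t θ ^ 2) t := by
    have hc := circInt_hopf_eq hv hp hh
    rw [SmoothPlane.cylInt_eq (hsa.sub hsb) (by linarith),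
      intervalIntegral.integral_congr (g := fun _ =>
        circInt (fun t θ => pt v t θ ^ 2 - pth v t θ ^ 2) 0), intervalIntegral.integral_const,
      smul_eq_mul] at hf
    · have h0 := (mul_eq_zero.1 hf).resolve_left (by linarith)
      intro t ht
      have h1 := hc t ht
      rw [h0, circInt, intervalIntegral.integral_sub (hsa.intervalIntegrable t _ _)
        (hsb.intervalIntegrable t _ _)] at h1
      exact sub_eq_zero.1 h1
    · intro t ht
      rw [uIcc_of_le (by linarith)] at ht
      exact hc t ⟨by linarith [ht.1], by linarith [ht.2]⟩
  set g : ℝ → ℝ := circInt fun t θ => pth v t θ ^ 2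
  have hgc : Continuous g := hsb.continuous_circInt
  set c : ℝ := circInt (pt v) 0 ^ 2 / (4 * π) with hc
  have hflux := circInt_pt_eq hv hp hh
  have hcg : ∀ t ∈ Set.Icc (0 : ℝ) (3 * L), 2 * c ≤ g t := fun t ht => by
    rw [← hzero t ht, hc, ← hflux t ht]
    refine le_of_eq_of_le ?_ (sq_integral_le_two_pi_mul (hv.pt.continuous_snd t))
    rw [circInt]
    field_simp
    ring
  have hcnn : 0 ≤ c := by positivity
  have henergy : ∀ a b, 0 ≤ a → a ≤ b → b ≤ 3 * L →
      cylInt (fun t θ => pt v t θ ^ 2 + pth v t θ ^ 2) a b = 2 * ∫ t in a..b, g t := by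
    intro a b ha hab hb
    rw [SmoothPlane.cylInt_eq (hsa.add hsb) hab, ← intervalIntegral.integral_const_mul]
    refine intervalIntegral.integral_congr fun t ht => ?_
    rw [uIcc_of_le hab] at ht
    have h1 := hzero t ⟨ha.trans ht.1, ht.2.trans hb⟩
    exact (intervalIntegral.integral_add (hsa.intervalIntegrable t _ _)
      (hsb.intervalIntegrable t _ _)).trans ((congrArg (· + g t) h1).trans (two_mul _).symm)
  have hpoint : ∀ t ∈ Set.Icc L (2 * L),
      2 * Real.cosh (2 * L) * (g t - c) ≤ (g (t - L) - c) + (g (t + L) - c) := fun t ht =>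
    two_mul_cosh_mul_le_add (a := 0) (b := 3 * L)
      (fun s => (hasDerivAt_circInt_sq hv.pth s).sub_const c)
      (hasDerivAt_circInt_two_mul_mul_pt hv.pth)
      (fun s hs => by
        rw [hc, ← hflux s hs]
        exact four_mul_angular_energy_le hv hp (hh s hs) (hzero s hs))
      hL0.le (by linarith [ht.1]) (by linarith [ht.2])
  have hpoint' : ∀ t ∈ Set.Icc L (2 * L),
      Real.exp (q * L) * g t ≤ g (t - L) + g (t + L) := fun t ht => by
    have h1 := hpoint t ht
    have h2 := hcg t ⟨by linarith [ht.1], by linarith [ht.2]⟩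
    calc Real.exp (q * L) * g t ≤ Real.cosh (2 * L) * g t :=
          mul_le_mul_of_nonneg_right hcosh (by linarith)
      _ ≤ Real.cosh (2 * L) * (2 * (g t - c)) :=
          mul_le_mul_of_nonneg_left (by linarith) (Real.cosh_pos _).le
      _ ≤ g (t - L) + g (t + L) := by linarith
  have hint : Real.exp (q * L) * ∫ t in L..(2 * L), g t
      ≤ (∫ t in (0 : ℝ)..L, g t) + ∫ t in (2 * L)..(3 * L), g t := by
    have hminus : Continuous fun t => g (t - L) := by fun_prop
    have hplus : Continuous fun t => g (t + L) := by fun_prop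
    have h := intervalIntegral.integral_mono_on (μ := volume) (by linarith : L ≤ 2 * L)
      ((hgc.intervalIntegrable _ _).const_mul (Real.exp (q * L)))
      ((hminus.intervalIntegrable _ _).add (hplus.intervalIntegrable _ _)) hpoint'
    rw [intervalIntegral.integral_const_mul, intervalIntegral.integral_add
      (hminus.intervalIntegrable _ _) (hplus.intervalIntegrable _ _),
      intervalIntegral.integral_comp_sub_right, intervalIntegral.integral_comp_add_right] at h
    ring_nf at h ⊢
    exact h
  rw [henergy _ _ hL0.le (by linarith) (by linarith), henergy _ _ le_rfl hL0.le (by linarith),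
    henergy _ _ (by linarith) (by linarith) le_rfl, neg_mul, Real.exp_neg,
    ← div_eq_inv_mul, le_div_iff₀ (Real.exp_pos _)]
  linarith
end
end

section
/- (Discrete three-circle decay lemma.) For all 0 < q' < q there exist L₁ > 0 and C > 0 (depending on q, q') such that for every L > L₁ the following holds: if k ≥ 2 is an integer and Φ₁, …, Φ_k are nonnegative real numbers satisfying Φ_i ≤ e^{−qL}(Φ_{i−1} + Φ_{i+1}) for all 2 ≤ i ≤ k−1, then for every 1 ≤ i ≤ k one has Φ_i ≤ C ( e^{−q'(i−1)L} Φ₁ + e^{−q'(k−i)L} Φ_k ). -/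
noncomputable section

open Real MeasureTheory Set Filter
open scoped InnerProductSpace

variable {n : ℕ}

/-- Discrete maximum principle: a subsolution of `D i = a * (D (i - 1) + D (i + 1))` with
`0 ≤ a` and `2 * a < 1` which is nonpositive at both ends is nonpositive everywhere. -/
theorem nonpos_of_le_mul_add_neighbors {a : ℝ} (ha : 0 ≤ a) (ha2 : 2 * a < 1) {k : ℕ}
    {D : ℕ → ℝ} (h1 : D 1 ≤ 0) (hk : D k ≤ 0)
    (hD : ∀ i : ℕ, 2 ≤ i → i ≤ k - 1 → D i ≤ a * (D (i - 1) + D (i + 1)))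
    {i : ℕ} (hi1 : 1 ≤ i) (hik : i ≤ k) : D i ≤ 0 := by
  obtain ⟨m, hm, hmax⟩ := (Finset.Icc 1 k).exists_max_image D
    ⟨i, Finset.mem_Icc.2 ⟨hi1, hik⟩⟩
  rw [Finset.mem_Icc] at hm
  refine (hmax i (Finset.mem_Icc.2 ⟨hi1, hik⟩)).trans ?_
  rcases eq_or_ne m 1 with rfl | hm1
  · exact h1
  rcases eq_or_ne m k with rfl | hmk
  · exact hk
  have hle := hD m (by omega) (by omega)
  have hl := hmax (m - 1) (Finset.mem_Icc.2 (by omega))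
  have hr := hmax (m + 1) (Finset.mem_Icc.2 (by omega))
  have hmul := mul_le_mul_of_nonneg_left (add_le_add hl hr) ha
  by_contra! hpos
  nlinarith

/-- If `exp (-(q - q') * L) ≤ 1 / 2`, the exponential with rate `q'` is a supersolution of the
three-term inequality with rate `q`. -/
theorem exp_mul_exp_add_exp_le {q q' L : ℝ} (hL : 0 ≤ q' * L)
    (h : Real.exp (-(q - q') * L) ≤ 1 / 2) (s : ℝ) :
    Real.exp (-q * L) * (Real.exp (s + q' * L) + Real.exp (s - q' * L)) ≤ Real.exp s := by
  have hmono : Real.exp (s - q' * L) ≤ Real.exp (s + q' * L) :=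
    Real.exp_le_exp.2 (by linarith)
  calc Real.exp (-q * L) * (Real.exp (s + q' * L) + Real.exp (s - q' * L))
      ≤ Real.exp (-q * L) * (Real.exp (s + q' * L) + Real.exp (s + q' * L)) := by gcongr
    _ = 2 * (Real.exp (-q * L) * Real.exp (s + q' * L)) := by ring
    _ = 2 * (Real.exp (-(q - q') * L) * Real.exp s) := by
        rw [← Real.exp_add, ← Real.exp_add]; ring_nf
    _ ≤ 2 * (1 / 2 * Real.exp s) := by gcongr
    _ = Real.exp s := by ring

/-- **Discrete three-circle decay lemma.** -/
theorem discrete_three_circle_decay (q q' : ℝ) (hq' : 0 < q') (hqq : q' < q) :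
    ∃ L₁ > (0 : ℝ), ∃ C > (0 : ℝ), ∀ L > L₁, ∀ k : ℕ, 2 ≤ k → ∀ Φ : ℕ → ℝ,
      (∀ i : ℕ, 1 ≤ i → i ≤ k → 0 ≤ Φ i) →
      (∀ i : ℕ, 2 ≤ i → i ≤ k - 1 → Φ i ≤ Real.exp (-q * L) * (Φ (i - 1) + Φ (i + 1))) →
      ∀ i : ℕ, 1 ≤ i → i ≤ k →
        Φ i ≤ C * (Real.exp (-q' * ((i : ℝ) - 1) * L) * Φ 1
          + Real.exp (-q' * ((k : ℝ) - (i : ℝ)) * L) * Φ k) := by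
  have hd : 0 < q - q' := sub_pos.2 hqq
  refine ⟨Real.log 2 / (q - q'), div_pos (Real.log_pos one_lt_two) hd, 1, one_pos, ?_⟩
  intro L hL k hk Φ hΦ hrec i hi1 hik
  have hL0 : 0 < L := (div_pos (Real.log_pos one_lt_two) hd).trans hL
  have hq'L : 0 < q' * L := mul_pos hq' hL0
  have hhalf : Real.exp (-(q - q') * L) ≤ 1 / 2 := by
    rw [← Real.le_log_iff_exp_le (by norm_num), one_div, Real.log_inv]
    have := (div_lt_iff₀ hd).1 hL
    linarith
  have ha2 : 2 * Real.exp (-q * L) < 1 := by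
    have : Real.exp (-q * L) < Real.exp (-(q - q') * L) := Real.exp_lt_exp.2 (by linarith)
    linarith
  have h1 : 0 ≤ Φ 1 := hΦ 1 le_rfl (by omega)
  have h2 : 0 ≤ Φ k := hΦ k (by omega) le_rfl
  rw [one_mul, ← sub_nonpos]
  refine nonpos_of_le_mul_add_neighbors
    (D := fun j : ℕ => Φ j - (Real.exp (-q' * ((j : ℝ) - 1) * L) * Φ 1
      + Real.exp (-q' * ((k : ℝ) - (j : ℝ)) * L) * Φ k))
    (Real.exp_pos (-q * L)).le ha2 ?_ ?_ ?_ hi1 hik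
  · have := mul_nonneg (Real.exp_pos (-q' * ((k : ℝ) - (1 : ℕ)) * L)).le h2
    simp at this ⊢
    linarith
  · have := mul_nonneg (Real.exp_pos (-q' * ((k : ℝ) - 1) * L)).le h1
    simp at this ⊢
    linarith
  · intro j hj hjk
    have hr := hrec j hj hjk
    have hs1 := mul_le_mul_of_nonneg_right
      (exp_mul_exp_add_exp_le hq'L.le hhalf (-q' * ((j : ℝ) - 1) * L)) h1
    have hs2 := mul_le_mul_of_nonneg_right
      (exp_mul_exp_add_exp_le hq'L.le hhalf (-q' * ((k : ℝ) - (j : ℝ)) * L)) h2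
    have e1 : -q' * ((j : ℝ) - 1) * L + q' * L = -q' * ((j : ℝ) - 1 - 1) * L := by ring
    have e2 : -q' * ((j : ℝ) - 1) * L - q' * L = -q' * ((j : ℝ) + 1 - 1) * L := by ring
    have e3 : -q' * ((k : ℝ) - j) * L + q' * L = -q' * ((k : ℝ) - (j + 1)) * L := by ring
    have e4 : -q' * ((k : ℝ) - j) * L - q' * L = -q' * ((k : ℝ) - (j - 1)) * L := by ring
    rw [e1, e2] at hs1
    rw [e3, e4] at hs2
    push_cast [Nat.cast_sub (show 1 ≤ j by omega)]
    linarith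
end
end

section
/- (Liouville theorem for periodic harmonic functions with bounded gradient.) Let β > 0 and let u : ℝ² → ℝ be harmonic (∂_t²u + ∂_θ²u = 0), 2π-periodic in the second variable θ, with |∇u(t,θ)| ≤ β for all (t,θ) ∈ ℝ². Then there exist constants a, c ∈ ℝ with |a| ≤ β such that u(t,θ) = a t + c for all (t,θ). -/
noncomputable section

open Real MeasureTheory Set Filter
open scoped InnerProductSpace

variable {n : ℕ}

theorem fderiv_re_im_apply_one {w : ℝ → ℝ → ℝ} {z : ℂ}
    (hw : DifferentiableAt ℝ (fun z : ℂ => w z.re z.im) z) :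
    fderiv ℝ (fun z : ℂ => w z.re z.im) z 1 = pt w z.re z.im := by
  have hline : HasDerivAt (fun s : ℝ => (⟨s, z.im⟩ : ℂ)) 1 z.re := by
    simp_rw [Complex.mk_eq_add_mul_I]
    simpa using (hasDerivAt_id z.re).ofReal_comp.add_const ((z.im : ℂ) * Complex.I)
  exact (hw.hasFDerivAt.comp_hasDerivAt z.re hline).deriv.symm

theorem fderiv_re_im_apply_I {w : ℝ → ℝ → ℝ} {z : ℂ}
    (hw : DifferentiableAt ℝ (fun z : ℂ => w z.re z.im) z) :
    fderiv ℝ (fun z : ℂ => w z.re z.im) z Complex.I = pth w z.re z.im := by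
  have hline : HasDerivAt (fun s : ℝ => (⟨z.re, s⟩ : ℂ)) Complex.I z.im := by
    simp_rw [Complex.mk_eq_add_mul_I]
    simpa using ((hasDerivAt_id z.im).ofReal_comp.mul_const Complex.I).const_add (z.re : ℂ)
  exact (hw.hasFDerivAt.comp_hasDerivAt z.im hline).deriv.symm

theorem harmonicAt_re_im {w : ℝ → ℝ → ℝ} (hw : ContDiff ℝ 2 (fun z : ℂ => w z.re z.im))
    (hharm : ∀ t θ : ℝ, pt (pt w) t θ + pth (pth w) t θ = 0) (z : ℂ) :
    InnerProductSpace.HarmonicAt (fun z : ℂ => w z.re z.im) z := by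
  have hd : Differentiable ℝ (fun z : ℂ => w z.re z.im) := hw.differentiable (by norm_num)
  have hd' : Differentiable ℝ (fderiv ℝ (fun z : ℂ => w z.re z.im)) :=
    (hw.fderiv_right (m := 1) (by norm_num)).differentiable (by norm_num)
  have h_one : (fun y => fderiv ℝ (fun z : ℂ => w z.re z.im) y 1) =
      fun y : ℂ => pt w y.re y.im := funext fun y => fderiv_re_im_apply_one (hd y)
  have h_I : (fun y => fderiv ℝ (fun z : ℂ => w z.re z.im) y Complex.I) =
      fun y : ℂ => pth w y.re y.im := funext fun y => fderiv_re_im_apply_I (hd y)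
  have hd_eval (v : ℂ) :
      Differentiable ℝ (fun y => fderiv ℝ (fun z : ℂ => w z.re z.im) y v) :=
    hd'.clm_apply (differentiable_const v)
  have h_second (v y : ℂ) : fderiv ℝ (fderiv ℝ (fun z : ℂ => w z.re z.im)) y v v =
      fderiv ℝ (fun x => fderiv ℝ (fun z : ℂ => w z.re z.im) x v) y v := by
    rw [fderiv_clm_apply (hd' y) (differentiableAt_const v)]
    simp
  refine ⟨hw.contDiffAt, Eventually.of_forall fun y => ?_⟩
  simp only [InnerProductSpace.laplacian_eq_iteratedFDeriv_complexPlane,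
    iteratedFDeriv_two_apply, Matrix.cons_val_zero, Matrix.cons_val_one, Pi.zero_apply]
  rw [h_second, h_second, h_one, h_I, fderiv_re_im_apply_one (h_one ▸ hd_eval 1 y),
    fderiv_re_im_apply_I (h_I ▸ hd_eval Complex.I y)]
  exact hharm _ _

theorem abs_pt_le_gradNorm (u : ℝ → ℝ → ℝ) (t θ : ℝ) : |pt u t θ| ≤ gradNorm u t θ :=
  Real.abs_le_sqrt (le_add_of_nonneg_right (sq_nonneg _))

theorem abs_pth_le_gradNorm (u : ℝ → ℝ → ℝ) (t θ : ℝ) : |pth u t θ| ≤ gradNorm u t θ :=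
  Real.abs_le_sqrt (le_add_of_nonneg_left (sq_nonneg _))

/-- A harmonic function on the plane with bounded gradient has constant partial derivatives. -/
theorem partials_const_of_harmonic_of_gradNorm_le {β : ℝ} {u : ℝ → ℝ → ℝ}
    (hu : ContDiff ℝ 2 (fun z : ℂ => u z.re z.im))
    (hharm : ∀ t θ : ℝ, pt (pt u) t θ + pth (pth u) t θ = 0)
    (hgrad : ∀ t θ : ℝ, gradNorm u t θ ≤ β) :
    ∃ a b : ℝ, ∀ t θ : ℝ, pt u t θ = a ∧ pth u t θ = b := by
  have hd : Differentiable ℝ (fun z : ℂ => u z.re z.im) := hu.differentiable (by norm_num)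
  set g : ℂ → ℂ := fun z => pt u z.re z.im - Complex.I * pth u z.re z.im with hg
  have hg_diff : Differentiable ℂ g := fun z => by
    simpa only [fderiv_re_im_apply_one (hd _), fderiv_re_im_apply_I (hd _)] using
      HarmonicAt.differentiableAt_complex_partial (harmonicAt_re_im hu hharm z)
  have hg_bdd : Bornology.IsBounded (range g) := by
    refine (Metric.isBounded_closedBall (x := (0 : ℂ)) (r := β + β)).subset ?_
    rintro _ ⟨z, rfl⟩
    rw [mem_closedBall_zero_iff]
    refine (norm_sub_le _ _).trans (add_le_add ?_ ?_)
    · simpa using (abs_pt_le_gradNorm u z.re z.im).trans (hgrad _ _)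
    · simpa using (abs_pth_le_gradNorm u z.re z.im).trans (hgrad _ _)
  refine ⟨pt u 0 0, pth u 0 0, fun t θ => ?_⟩
  have h := hg_diff.apply_eq_apply_of_bounded hg_bdd ⟨t, θ⟩ 0
  exact ⟨by simpa [hg] using congrArg Complex.re h, by simpa [hg] using congrArg Complex.im h⟩

/-- **Liouville theorem** for periodic harmonic functions with bounded gradient. -/
theorem liouville_periodic_harmonic (β : ℝ) (hβ : 0 < β) (u : ℝ → ℝ → ℝ)
    (hsm : ContDiff ℝ (⊤ : ℕ∞) (fun p : ℝ × ℝ => u p.1 p.2))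
    (hper : ∀ t θ : ℝ, u t (θ + 2 * π) = u t θ)
    (hharm : ∀ t θ : ℝ, pt (pt u) t θ + pth (pth u) t θ = 0)
    (hgrad : ∀ t θ : ℝ, gradNorm u t θ ≤ β) :
    ∃ a c : ℝ, |a| ≤ β ∧ ∀ t θ : ℝ, u t θ = a * t + c := by
  have hu : ContDiff ℝ (⊤ : ℕ∞) (fun z : ℂ => u z.re z.im) :=
    hsm.comp (Complex.reCLM.contDiff.prodMk Complex.imCLM.contDiff)
  obtain ⟨a, b, hab⟩ :=
    partials_const_of_harmonic_of_gradNorm_le (contDiff_infty.1 hu 2) hharm hgrad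
  have hdiff : Differentiable ℝ (fun p : ℝ × ℝ => u p.1 p.2) := hsm.differentiable (by simp)
  have ht (t θ : ℝ) : u t θ = a * t + u 0 θ := by
    have hd : Differentiable ℝ fun s => u s θ - a * s :=
      (hdiff.comp (differentiable_id.prodMk (differentiable_const θ))).sub (by fun_prop)
    have hz (s : ℝ) : deriv (fun s => u s θ - a * s) s = 0 := by
      have hs : DifferentiableAt ℝ (fun s => u s θ) s :=
        (hdiff.comp (differentiable_id.prodMk (differentiable_const θ))) s
      rw [deriv_fun_sub hs (by fun_prop), show deriv (fun s => u s θ) s = a from (hab s θ).1]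
      simp
    have := is_const_of_deriv_eq_zero hd hz t 0
    linarith
  have hθ (θ : ℝ) : u 0 θ = b * θ + u 0 0 := by
    have hd : Differentiable ℝ fun s => u 0 s - b * s :=
      (hdiff.comp ((differentiable_const (0 : ℝ)).prodMk differentiable_id)).sub (by fun_prop)
    have hz (s : ℝ) : deriv (fun s => u 0 s - b * s) s = 0 := by
      have hs : DifferentiableAt ℝ (fun s => u 0 s) s :=
        (hdiff.comp ((differentiable_const (0 : ℝ)).prodMk differentiable_id)) s
      rw [deriv_fun_sub hs (by fun_prop), show deriv (fun s => u 0 s) s = b from (hab 0 s).2]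
      simp
    have := is_const_of_deriv_eq_zero hd hz θ 0
    linarith
  have hb : b = 0 := by
    have h := hper 0 0
    rw [hθ (0 + 2 * π), zero_add, add_eq_right] at h
    exact (mul_eq_zero.1 h).resolve_right Real.two_pi_pos.ne'
  refine ⟨a, u 0 0, ?_, fun t θ => ?_⟩
  · rw [← (hab 0 0).1]
    exact (abs_pt_le_gradNorm u 0 0).trans (hgrad 0 0)
  · rw [ht, hθ, hb, zero_mul, zero_add]
end
end
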